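/- There exists a constant C > 0 such that for every R > 0 and every w ∈ C¹ on the closed ball B(0,R) ⊂ ℝ³, setting Flux = ∫_{B(0,R)} ( ½|∇w(y)|² + w(y)⁶/6 ) dy, one has ∫_{B(0,R)} w(y)⁴ / |y| dy ≤ C ( Flux + Flux^{1/3} ). -/

import Mathlib

open MeasureTheory Metric
open scoped ENNReal

/-- Integration in polar coordinates for nonnegative functions. -/
theorem lintegral_eq_lintegral_toSphere {E : Type*} [NormedAddCommGroup E] [NormedSpace ℝ E]
    [Nontrivial E] [FiniteDimensional ℝ E] [MeasurableSpace E] [BorelSpace E]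
    (μ : Measure E) [μ.IsAddHaarMeasure] {f : E → ℝ≥0∞} (hf : Measurable f) :
    ∫⁻ x, f x ∂μ = ∫⁻ θ : sphere (0 : E) 1, ∫⁻ r in Set.Ioi (0 : ℝ),
      ENNReal.ofReal (r ^ (Module.finrank ℝ E - 1)) * f (r • (θ : E)) ∂volume ∂μ.toSphere := by
  have hmp := μ.measurePreserving_homeomorphUnitSphereProd.symm
    (homeomorphUnitSphereProd E).toMeasurableEquiv
  have hm : Measurable fun p : sphere (0 : E) 1 × Set.Ioi (0 : ℝ) => f (p.2.1 • p.1.1) :=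
    hf.comp (by fun_prop)
  calc ∫⁻ x, f x ∂μ = ∫⁻ x in ({0}ᶜ : Set E), f x ∂μ := by
        rw [restrict_compl_singleton]
    _ = ∫⁻ x : ({0}ᶜ : Set E), f x ∂(μ.comap Subtype.val) :=
        (lintegral_subtype_comap (measurableSet_singleton _).compl f).symm
    _ = ∫⁻ p, f (p.2.1 • p.1.1)
          ∂(μ.toSphere.prod (Measure.volumeIoiPow (Module.finrank ℝ E - 1))) := by
        exact (hmp.lintegral_comp (hf.comp measurable_subtype_coe)).symm
    _ = _ := by
        rw [lintegral_prod _ hm.aemeasurable]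
        refine lintegral_congr fun θ => ?_
        exact (lintegral_withDensity_eq_lintegral_mul _ (by fun_prop)
          (hm.comp measurable_prodMk_left)).trans (lintegral_subtype_comap measurableSet_Ioi
            fun r : ℝ => ENNReal.ofReal (r ^ (Module.finrank ℝ E - 1)) * f (r • (θ : E)))

/-- A one-dimensional weighted estimate, obtained by integrating the derivative of
`φ ^ 4 * (r ^ 2 - r ^ 3 / R)`, which vanishes at both ends of `[0, R]`. -/
theorem intervalIntegral_two_mul_pow_four_le {R : ℝ} (hR : 0 < R) {φ ψ : ℝ → ℝ}
    (hφ : ContinuousOn φ (Set.Icc 0 R)) (hψ : ContinuousOn ψ (Set.Icc 0 R))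
    (hd : ∀ r ∈ Set.Ioo 0 R, HasDerivAt φ (ψ r) r) :
    ∫ r in (0 : ℝ)..R, 2 * r * φ r ^ 4 ≤
      ∫ r in (0 : ℝ)..R, r ^ 2 * (3 / R * φ r ^ 4 + 4 * |φ r| ^ 3 * |ψ r|) := by
  have hu : Set.uIcc 0 R = Set.Icc 0 R := Set.uIcc_of_le hR.le
  have hφ' : ContinuousOn φ (Set.uIcc 0 R) := hu ▸ hφ
  have hψ' : ContinuousOn ψ (Set.uIcc 0 R) := hu ▸ hψ
  set H' : ℝ → ℝ := fun r =>
    4 * φ r ^ 3 * ψ r * (r ^ 2 - r ^ 3 / R) + φ r ^ 4 * (2 * r - 3 * r ^ 2 / R)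
  have hH' : IntervalIntegrable H' volume 0 R :=
    ContinuousOn.intervalIntegrable (by fun_prop)
  have hzero : ∫ r in (0 : ℝ)..R, H' r = 0 := by
    rw [intervalIntegral.integral_eq_sub_of_hasDerivAt_of_le
      (f := fun r => φ r ^ 4 * (r ^ 2 - r ^ 3 / R)) hR.le (by fun_prop) _ hH']
    · field_simp
      ring
    · intro r hr
      refine (((hd r hr).fun_pow 4).fun_mul
        ((hasDerivAt_pow 2 r).fun_sub ((hasDerivAt_pow 3 r).div_const R))).congr_deriv ?_
      simp [H']
  have hL : IntervalIntegrable (fun r => 2 * r * φ r ^ 4) volume 0 R :=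
    ContinuousOn.intervalIntegrable (by fun_prop)
  have hsub := intervalIntegral.integral_sub hL hH'
  rw [hzero, sub_zero] at hsub
  rw [← hsub]
  refine intervalIntegral.integral_mono_on hR.le (hL.sub hH')
    (ContinuousOn.intervalIntegrable (by fun_prop)) fun r hr => ?_
  have h0 : 0 ≤ r ^ 3 / R := by have := hr.1; positivity
  have h1 : r ^ 3 / R ≤ r ^ 2 := by
    rw [div_le_iff₀ hR]
    nlinarith [mul_nonneg (sq_nonneg r) (sub_nonneg.2 hr.2)]
  have h2 : -(φ r ^ 3 * ψ r) ≤ |φ r| ^ 3 * |ψ r| := by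
    rw [← abs_pow, ← abs_mul]
    exact neg_le_abs _
  have h3 : 0 ≤ |φ r| ^ 3 * |ψ r| := by positivity
  have e : r ^ 2 * (3 / R * φ r ^ 4) = φ r ^ 4 * (3 * r ^ 2 / R) := by ring
  simp only [H', mul_add, e]
  nlinarith [mul_le_mul_of_nonneg_right h2 (sub_nonneg.2 h1), mul_nonneg h3 h0]

/-- The version of `intervalIntegral_two_mul_pow_four_le` for Lebesgue integrals, with a
continuous majorant on the right-hand side. -/
theorem setLIntegral_two_mul_pow_four_le {R : ℝ} (hR : 0 < R) {φ ψ G : ℝ → ℝ}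
    (hφ : ContinuousOn φ (Set.Icc 0 R)) (hψ : ContinuousOn ψ (Set.Icc 0 R))
    (hd : ∀ r ∈ Set.Ioo 0 R, HasDerivAt φ (ψ r) r)
    (hG : ∀ r ∈ Set.Ioo 0 R, 3 / R * φ r ^ 4 + 4 * |φ r| ^ 3 * |ψ r| ≤ G r) :
    ∫⁻ r in Set.Ioo 0 R, ENNReal.ofReal (2 * r * φ r ^ 4) ≤
      ∫⁻ r in Set.Ioo 0 R, ENNReal.ofReal (r ^ 2 * G r) := by
  have key := intervalIntegral_two_mul_pow_four_le hR hφ hψ hd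
  rw [intervalIntegral.integral_of_le hR.le, intervalIntegral.integral_of_le hR.le,
    integral_Ioc_eq_integral_Ioo, integral_Ioc_eq_integral_Ioo] at key
  have hint : ∀ {F : ℝ → ℝ}, ContinuousOn F (Set.Icc 0 R) → IntegrableOn F (Set.Ioo 0 R) :=
    fun hF => hF.integrableOn_Icc.mono_set Set.Ioo_subset_Icc_self
  calc ∫⁻ r in Set.Ioo 0 R, ENNReal.ofReal (2 * r * φ r ^ 4)
      = ENNReal.ofReal (∫ r in Set.Ioo 0 R, 2 * r * φ r ^ 4) := by
        refine (ofReal_integral_eq_lintegral_ofReal (hint (by fun_prop)) ?_).symm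
        filter_upwards [ae_restrict_mem measurableSet_Ioo] with r hr
        have := hr.1
        simp only [Pi.zero_apply]
        positivity
    _ ≤ ENNReal.ofReal (∫ r in Set.Ioo 0 R,
          r ^ 2 * (3 / R * φ r ^ 4 + 4 * |φ r| ^ 3 * |ψ r|)) := ENNReal.ofReal_le_ofReal key
    _ = ∫⁻ r in Set.Ioo 0 R,
          ENNReal.ofReal (r ^ 2 * (3 / R * φ r ^ 4 + 4 * |φ r| ^ 3 * |ψ r|)) := by
        refine ofReal_integral_eq_lintegral_ofReal (hint (by fun_prop)) (.of_forall fun r => ?_)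
        simp only [Pi.zero_apply]
        positivity
    _ ≤ _ := by
        refine setLIntegral_mono' measurableSet_Ioo fun r hr => ?_
        exact ENNReal.ofReal_le_ofReal (mul_le_mul_of_nonneg_left (hG r hr) (sq_nonneg r))

/-- Polar coordinates on a ball of `ℝ³`. -/
theorem setLIntegral_ball_eq_lintegral_toSphere {R : ℝ}
    {f : EuclideanSpace ℝ (Fin 3) → ℝ≥0∞}
    (hf : Measurable ((ball (0 : EuclideanSpace ℝ (Fin 3)) R).indicator f)) :
    ∫⁻ y in ball (0 : EuclideanSpace ℝ (Fin 3)) R, f y =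
      ∫⁻ θ : sphere (0 : EuclideanSpace ℝ (Fin 3)) 1, ∫⁻ r in Set.Ioo 0 R,
        ENNReal.ofReal (r ^ 2) * f (r • (θ : EuclideanSpace ℝ (Fin 3)))
          ∂volume ∂volume.toSphere := by
  rw [← lintegral_indicator measurableSet_ball, lintegral_eq_lintegral_toSphere _ hf]
  refine lintegral_congr fun θ => ?_
  rw [← Set.Ioi_inter_Iio, Set.inter_comm, ← Measure.restrict_restrict measurableSet_Iio,
    ← lintegral_indicator measurableSet_Iio]
  refine setLIntegral_congr_fun measurableSet_Ioi fun r hr => ?_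
  have hθ : ‖(θ : EuclideanSpace ℝ (Fin 3))‖ = 1 := by simp
  have hiff : r • (θ : EuclideanSpace ℝ (Fin 3)) ∈ ball 0 R ↔ r ∈ Set.Iio R := by
    rw [mem_ball_zero_iff, norm_smul, hθ, mul_one, Real.norm_of_nonneg (le_of_lt hr), Set.mem_Iio]
  by_cases h : r ∈ Set.Iio R
  · simp [Set.indicator_of_mem h, Set.indicator_of_mem (hiff.2 h)]
  · simp [Set.indicator_of_notMem h, Set.indicator_of_notMem (mt hiff.1 h)]

/-- The indicator of a set applied to a function continuous on it is measurable. -/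
theorem ContinuousOn.measurable_indicator_ofReal {X : Type*} [TopologicalSpace X]
    [MeasurableSpace X] [OpensMeasurableSpace X] {f : X → ℝ} {s : Set X}
    (hf : ContinuousOn f s) (hs : MeasurableSet s) :
    Measurable (s.indicator fun x => ENNReal.ofReal (f x)) := by
  classical
  rw [← Set.piecewise_eq_indicator]
  exact (ENNReal.continuous_ofReal.comp_continuousOn hf).measurable_piecewise
    continuousOn_const hs

/-- Young's inequality for the terms of the weighted estimate. -/
theorem weighted_quartic_le {R l : ℝ} (hR : 0 < R) (hl : 0 < l) {a b d : ℝ} (hb : |b| ≤ d) :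
    3 / R * a ^ 4 + 4 * |a| ^ 3 * |b| ≤
      12 * (1 + l) * (1 / 2 * d ^ 2 + a ^ 6 / 6) + (l ^ 2 * R ^ 3)⁻¹ := by
  have hd : 0 ≤ d := (abs_nonneg b).trans hb
  have h1 : 4 * |a| ^ 3 * |b| ≤ 2 * a ^ 6 + 2 * d ^ 2 := by
    have e : a ^ 6 = (|a| ^ 3) ^ 2 := by rw [← pow_mul]; exact ((by decide : Even 6).pow_abs a).symm
    rw [e]
    nlinarith [sq_nonneg (|a| ^ 3 - d), mul_le_mul_of_nonneg_left hb (pow_nonneg (abs_nonneg a) 3)]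
  have h2 : 3 / R * a ^ 4 ≤ 2 * l * a ^ 6 + (l ^ 2 * R ^ 3)⁻¹ := by
    have hx : 0 ≤ l * R * a ^ 2 := by positivity
    have h : 3 * (l * R * a ^ 2) ^ 2 ≤ 2 * (l * R * a ^ 2) ^ 3 + 1 := by
      nlinarith [mul_nonneg (by linarith : 0 ≤ 2 * (l * R * a ^ 2) + 1)
        (sq_nonneg (l * R * a ^ 2 - 1))]
    have hk : 0 < l ^ 2 * R ^ 3 := by positivity
    have e1 : 3 / R * a ^ 4 = 3 * (l * R * a ^ 2) ^ 2 * (l ^ 2 * R ^ 3)⁻¹ := by field_simp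
    have e2 : 2 * l * a ^ 6 + (l ^ 2 * R ^ 3)⁻¹ =
        (2 * (l * R * a ^ 2) ^ 3 + 1) * (l ^ 2 * R ^ 3)⁻¹ := by field_simp
    rw [e1, e2]
    exact mul_le_mul_of_nonneg_right h (inv_nonneg.2 hk.le)
  nlinarith [mul_nonneg hl.le (sq_nonneg d)]

/-- Optimising the parameter in Young's inequality. -/
theorem le_add_rpow_of_forall_le {a : ℝ≥0∞} {f : ℝ} (hf : 0 ≤ f)
    (h : ∀ l : ℝ, 0 < l → a ≤ ENNReal.ofReal (6 * (1 + l) * f + 3 / l ^ 2)) :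
    a ≤ ENNReal.ofReal (15 * (f + f ^ ((1 : ℝ) / 3))) := by
  have step : ∀ g : ℝ, f < g → a ≤ ENNReal.ofReal (15 * (g + g ^ ((1 : ℝ) / 3))) := by
    intro g hg
    have hg0 : 0 < g := hf.trans_lt hg
    set s := g ^ ((1 : ℝ) / 3) with hs
    have hs0 : 0 < s := by positivity
    have hs3 : s ^ 3 = g := by
      rw [hs, ← Real.rpow_natCast, ← Real.rpow_mul hg0.le]
      norm_num
    refine (h s⁻¹ (by positivity)).trans (ENNReal.ofReal_le_ofReal ?_)
    have h1 : 6 * (1 + s⁻¹) * f ≤ 6 * (1 + s⁻¹) * g := by gcongr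
    have h2 : 6 * (1 + s⁻¹) * g = 6 * s ^ 3 + 6 * s ^ 2 := by rw [← hs3]; field_simp
    have h3 : 3 / s⁻¹ ^ 2 = 3 * s ^ 2 := by field_simp
    rw [h3]
    nlinarith [mul_nonneg hs0.le (sq_nonneg (s - 1)), pow_pos hs0 3]
  have hc : Continuous fun g : ℝ => ENNReal.ofReal (15 * (g + g ^ ((1 : ℝ) / 3))) :=
    ENNReal.continuous_ofReal.comp (continuous_const.mul
      (continuous_id.add (Real.continuous_rpow_const (by norm_num))))
  exact ge_of_tendsto (hc.tendsto f |>.mono_left nhdsWithin_le_nhds)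
    (Filter.eventually_of_mem self_mem_nhdsWithin step : ∀ᶠ g in nhdsWithin f (Set.Ioi f), _)

/-- There is a universal constant `C > 0` such that for every `R > 0`
and every `w` of class `C¹` on the closed ball `B(0,R) ⊂ ℝ³`, with
`Flux = ∫_{B(0,R)} (½|∇w|² + w⁶/6)`, one has
`∫_{B(0,R)} w⁴/|y| ≤ C (Flux + Flux^{1/3})`. -/
theorem quartic_cone_integral_flux_bound :
    ∃ C : ℝ, 0 < C ∧ ∀ R : ℝ, 0 < R → ∀ w : EuclideanSpace ℝ (Fin 3) → ℝ,
      ContDiffOn ℝ 1 w (Metric.closedBall 0 R) →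
      ∫⁻ y in Metric.ball (0 : EuclideanSpace ℝ (Fin 3)) R,
          ENNReal.ofReal ((w y) ^ 4 / ‖y‖)
        ≤ ENNReal.ofReal (C *
            ((∫ y in Metric.ball (0 : EuclideanSpace ℝ (Fin 3)) R,
                ((1/2) * ‖gradient w y‖ ^ 2 + (w y) ^ 6 / 6))
              + (∫ y in Metric.ball (0 : EuclideanSpace ℝ (Fin 3)) R,
                  ((1/2) * ‖gradient w y‖ ^ 2 + (w y) ^ 6 / 6)) ^ ((1:ℝ)/3))) := by
  refine ⟨15, by norm_num, fun R hR w hw => ?_⟩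
  set D := fderivWithin ℝ w (closedBall 0 R) with hD
  have huniq : UniqueDiffOn ℝ (closedBall (0 : EuclideanSpace ℝ (Fin 3)) R) :=
    uniqueDiffOn_convex (convex_closedBall _ _) (by
      rw [interior_closedBall _ hR.ne']
      exact ⟨0, mem_ball_self hR⟩)
  have hDc : ContinuousOn D (closedBall 0 R) := hw.continuousOn_fderivWithin huniq le_rfl
  have hwc : ContinuousOn w (closedBall 0 R) := hw.continuousOn
  have hnhds : ∀ y ∈ ball (0 : EuclideanSpace ℝ (Fin 3)) R, closedBall 0 R ∈ nhds y :=
    fun y hy => Filter.mem_of_superset (isOpen_ball.mem_nhds hy) ball_subset_closedBall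
  have hderiv : ∀ y ∈ ball (0 : EuclideanSpace ℝ (Fin 3)) R, HasFDerivAt w (D y) y := by
    intro y hy
    rw [hD, fderivWithin_of_mem_nhds (hnhds y hy)]
    exact ((hw.contDiffAt (hnhds y hy)).differentiableAt one_ne_zero).hasFDerivAt
  set e : EuclideanSpace ℝ (Fin 3) → ℝ := fun y => 1 / 2 * ‖D y‖ ^ 2 + w y ^ 6 / 6 with he
  have hec : ContinuousOn e (closedBall 0 R) := by fun_prop
  have he0 : ∀ y, 0 ≤ e y := fun y => by positivity
  have hflux : ∫ y in ball (0 : EuclideanSpace ℝ (Fin 3)) R,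
      ((1 / 2) * ‖gradient w y‖ ^ 2 + (w y) ^ 6 / 6) =
      ∫ y in ball (0 : EuclideanSpace ℝ (Fin 3)) R, e y := by
    refine setIntegral_congr_fun measurableSet_ball fun y hy => ?_
    have : ‖gradient w y‖ = ‖D y‖ := by
      rw [← (hderiv y hy).fderiv, ← toDual_gradient, LinearIsometryEquiv.norm_map]
    simp only [he, this]
  rw [hflux]
  have hei : IntegrableOn e (ball 0 R) :=
    (hec.integrableOn_compact (isCompact_closedBall 0 R)).mono_set ball_subset_closedBall
  refine le_add_rpow_of_forall_le (integral_nonneg he0) fun l hl => ?_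
  set g : EuclideanSpace ℝ (Fin 3) → ℝ :=
    fun y => 12 * (1 + l) * e y + (l ^ 2 * R ^ 3)⁻¹ with hg
  have hgc : ContinuousOn g (ball 0 R) := by
    have := hec.mono ball_subset_closedBall
    fun_prop
  have hg0 : ∀ y, 0 ≤ g y := fun y => by have := he0 y; positivity
  have hfm : Measurable ((ball (0 : EuclideanSpace ℝ (Fin 3)) R).indicator
      fun y => ENNReal.ofReal (2 * (w y ^ 4 / ‖y‖))) := by
    have h1 := (((hwc.mono ball_subset_closedBall).pow 4).const_smul
      (2 : ℝ)).measurable_indicator_ofReal measurableSet_ball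
    have h2 : Measurable fun y : EuclideanSpace ℝ (Fin 3) => ENNReal.ofReal ‖y‖⁻¹ := by fun_prop
    convert h1.mul h2 using 1
    ext y
    by_cases hy : y ∈ ball (0 : EuclideanSpace ℝ (Fin 3)) R
    · simp only [Set.indicator_of_mem hy, Pi.mul_apply, Pi.smul_apply, Pi.pow_apply, smul_eq_mul]
      rw [← ENNReal.ofReal_mul (by positivity)]
      congr 1
      ring
    · simp [Set.indicator_of_notMem hy]
  have hle : ∫⁻ y in ball (0 : EuclideanSpace ℝ (Fin 3)) R, ENNReal.ofReal (2 * (w y ^ 4 / ‖y‖)) ≤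
      ∫⁻ y in ball (0 : EuclideanSpace ℝ (Fin 3)) R, ENNReal.ofReal (g y) := by
    rw [setLIntegral_ball_eq_lintegral_toSphere hfm, setLIntegral_ball_eq_lintegral_toSphere
      (hgc.measurable_indicator_ofReal measurableSet_ball)]
    refine lintegral_mono fun θ => ?_
    have hθ : ‖(θ : EuclideanSpace ℝ (Fin 3))‖ = 1 := by simp
    have hnorm : ∀ r : ℝ, 0 ≤ r → ‖r • (θ : EuclideanSpace ℝ (Fin 3))‖ = r := fun r hr => by
      rw [norm_smul, hθ, mul_one, Real.norm_of_nonneg hr]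
    have hmaps : Set.MapsTo (fun r : ℝ => r • (θ : EuclideanSpace ℝ (Fin 3))) (Set.Icc 0 R)
        (closedBall 0 R) := fun r hr => by
      rw [mem_closedBall_zero_iff, hnorm r hr.1]
      exact hr.2
    have hray : ContinuousOn (fun r : ℝ => r • (θ : EuclideanSpace ℝ (Fin 3))) (Set.Icc 0 R) := by
      fun_prop
    have key := setLIntegral_two_mul_pow_four_le hR
      (φ := fun r => w (r • (θ : EuclideanSpace ℝ (Fin 3))))
      (ψ := fun r => D (r • (θ : EuclideanSpace ℝ (Fin 3))) θ)
      (G := fun r => g (r • (θ : EuclideanSpace ℝ (Fin 3))))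
      (hwc.comp hray hmaps) ((hDc.comp hray hmaps).clm_apply continuousOn_const)
      (fun r hr => by
        have hy : r • (θ : EuclideanSpace ℝ (Fin 3)) ∈ ball 0 R := by
          rw [mem_ball_zero_iff, hnorm r hr.1.le]
          exact hr.2
        have h1 : HasDerivAt (fun r : ℝ => r • (θ : EuclideanSpace ℝ (Fin 3))) θ r := by
          simpa using (hasDerivAt_id r).smul_const (θ : EuclideanSpace ℝ (Fin 3))
        exact (hderiv _ hy).comp_hasDerivAt r h1)
      (fun r _ => weighted_quartic_le hR hl (by
        simpa [hθ] using (D (r • (θ : EuclideanSpace ℝ (Fin 3)))).le_opNorm θ))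
    refine (le_of_eq ?_).trans (key.trans (le_of_eq ?_))
    · refine setLIntegral_congr_fun measurableSet_Ioo fun r hr => ?_
      have hr0 : r ≠ 0 := hr.1.ne'
      rw [← ENNReal.ofReal_mul (sq_nonneg r), hnorm r hr.1.le]
      congr 1
      field_simp
    · refine setLIntegral_congr_fun measurableSet_Ioo fun r hr => ?_
      exact ENNReal.ofReal_mul (sq_nonneg r)
  have hconst : IntegrableOn (fun _ : EuclideanSpace ℝ (Fin 3) => (l ^ 2 * R ^ 3)⁻¹) (ball 0 R) :=
    integrableOn_const measure_ball_lt_top.ne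
  have hgint : ∫ y in ball (0 : EuclideanSpace ℝ (Fin 3)) R, g y =
      12 * (1 + l) * (∫ y in ball (0 : EuclideanSpace ℝ (Fin 3)) R, e y) +
        Real.pi * 4 / 3 / l ^ 2 := by
    rw [integral_add (hei.const_mul _) hconst, integral_const_mul, setIntegral_const,
      measureReal_def, EuclideanSpace.volume_ball_fin_three, ENNReal.toReal_mul,
      ENNReal.toReal_pow, ENNReal.toReal_ofReal hR.le, ENNReal.toReal_ofReal (by positivity),
      smul_eq_mul]
    field_simp
  have hgi : IntegrableOn g (ball 0 R) := (hei.const_mul _).add hconst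
  rw [← ofReal_integral_eq_lintegral_ofReal hgi (.of_forall hg0), hgint] at hle
  have htwo : ∫⁻ y in ball (0 : EuclideanSpace ℝ (Fin 3)) R,
      ENNReal.ofReal (2 * (w y ^ 4 / ‖y‖)) =
      ENNReal.ofReal 2 *
        ∫⁻ y in ball (0 : EuclideanSpace ℝ (Fin 3)) R, ENNReal.ofReal (w y ^ 4 / ‖y‖) := by
    rw [← lintegral_const_mul' _ _ ENNReal.ofReal_ne_top]
    exact lintegral_congr fun y => ENNReal.ofReal_mul zero_le_two
  rw [htwo] at hle
  refine (ENNReal.mul_le_mul_iff_right (ENNReal.ofReal_pos.2 two_pos).ne'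
    ENNReal.ofReal_ne_top).1 (hle.trans ?_)
  rw [← ENNReal.ofReal_mul zero_le_two]
  refine ENNReal.ofReal_le_ofReal ?_
  have hpi : Real.pi * 4 / 3 / l ^ 2 ≤ 6 / l ^ 2 := by
    gcongr
    linarith [Real.pi_lt_four]
  have : 2 * (3 / l ^ 2) = 6 / l ^ 2 := by ring
  linarith
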